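/- Let P = {1,…,p} be a finite index set and let M(1), …, M(p) be real n×n matrices each of which is exponentially stable (Hurwitz). Then for every average dwell time τ_D > 0, every chatter bound N₀ > 0, and every preassigned convergence rate λ > 0, there exist a positive number g and a constant c' ≥ 1 such that for every piecewise-constant switching signal σ : [0,∞) → P whose number of discontinuities in any open interval (τ, t) is at most N₀ + (t − τ)/τ_D, every differentiable function x : [0,∞) → ℝⁿ satisfying ẋ(t) = g M(σ(t)) x(t) for all t ≥ 0 obeys ‖x(t)‖ ≤ c' e^{−λ t} ‖x(0)‖ for all t ≥ 0. -/

import Mathlib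

open Set Filter Matrix

/-- The set of points where `σ` is not locally constant (its discontinuity points,
giving the codomain the discrete topology). -/
def Discont {P : Type*} (σ : ℝ → P) : Set ℝ := {s : ℝ | ¬ ∀ᶠ u in nhds s, σ u = σ s}

/-- `σ` is piecewise constant: there is an unbounded increasing sequence of times starting
at `0` such that `σ` is constant on each interval between consecutive times. -/
def PiecewiseConstant {P : Type*} (σ : ℝ → P) : Prop :=
  ∃ T : ℕ → ℝ, T 0 = 0 ∧ StrictMono T ∧ Tendsto T atTop atTop ∧
    ∀ k : ℕ, ∀ s ∈ Set.Ico (T k) (T (k + 1)), σ s = σ (T k)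

/-- `σ` is a piecewise-constant switching signal with average dwell time `τD` and chatter
bound `N₀`: the number of its discontinuities in any open interval `(τ, t)` is at most
`N₀ + (t - τ) / τD`. -/
def HasAvgDwellTime {P : Type*} (τD N₀ : ℝ) (σ : ℝ → P) : Prop :=
  PiecewiseConstant σ ∧ ∀ τ t : ℝ, 0 ≤ τ → τ ≤ t →
    ((Discont σ ∩ Set.Ioo τ t).ncard : ℝ) ≤ N₀ + (t - τ) / τD

/-- A real square matrix is Hurwitz (exponentially stable) if all of its complex
eigenvalues have negative real part. -/
def Hurwitz {n : ℕ} (M : Matrix (Fin n) (Fin n) ℝ) : Prop :=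
  ∀ μ ∈ spectrum ℂ (M.map (algebraMap ℝ ℂ)), μ.re < 0


lemma exists_lin_bound {E F : Type*} [NormedAddCommGroup E] [NormedSpace ℝ E]
    [NormedAddCommGroup F] [NormedSpace ℝ F] [FiniteDimensional ℝ E] (L : E →ₗ[ℝ] F) :
    ∃ K > (0 : ℝ), ∀ x, ‖L x‖ ≤ K * ‖x‖ := by
  let L' := LinearMap.toContinuousLinearMap L
  refine ⟨‖L'‖ + 1, by positivity, fun x => (L'.le_opNorm x).trans ?_⟩
  gcongr
  linarith

section PowBound
open scoped Matrix.Norms.Operator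

lemma cpow_bound {n : ℕ} (A : Matrix (Fin n) (Fin n) ℂ)
    (hA : ∀ μ ∈ spectrum ℂ A, μ.re < 0) :
    ∃ ε > (0 : ℝ), ∃ r : ℝ, 0 < r ∧ r < 1 ∧ ∃ C > (0 : ℝ), ∀ k : ℕ,
      ‖(1 + (ε : ℂ) • A) ^ k‖ ≤ C * r ^ k := by
  rcases Nat.eq_zero_or_pos n with rfl | hn
  · refine ⟨1, one_pos, 1 / 2, by norm_num, by norm_num, 1, one_pos, fun k => ?_⟩
    rw [Subsingleton.elim ((1 + ((1 : ℝ) : ℂ) • A) ^ k) 0, norm_zero]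
    positivity
  have : Nonempty (Fin n) := ⟨⟨0, hn⟩⟩
  have h1 : ∀ᶠ ε : ℝ in nhdsWithin 0 (Ioi 0), ∀ μ ∈ spectrum ℂ A, ‖1 + (ε : ℂ) * μ‖ < 1 := by
    rw [(Matrix.finite_spectrum A).eventually_all]
    intro μ hμ
    have hre := hA μ hμ
    have h2 : ∀ᶠ ε : ℝ in nhds 0, 2 * μ.re + ε * (μ.re ^ 2 + μ.im ^ 2) < 0 := by
      have hc : Continuous fun ε : ℝ => 2 * μ.re + ε * (μ.re ^ 2 + μ.im ^ 2) := by fun_prop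
      exact (hc.tendsto 0).eventually_lt_const (by simp; linarith)
    filter_upwards [nhdsWithin_le_nhds h2, self_mem_nhdsWithin] with ε hε hpos
    have hpos : 0 < ε := hpos
    have h3 : ‖1 + (ε : ℂ) * μ‖ ^ 2 < 1 := by
      rw [← Complex.normSq_eq_norm_sq, Complex.normSq_apply]
      simp
      nlinarith [mul_neg_of_pos_of_neg hpos hε]
    nlinarith [norm_nonneg (1 + (ε : ℂ) * μ)]
  obtain ⟨ε, hε, hpos⟩ := (h1.and self_mem_nhdsWithin).exists
  have hpos : 0 < ε := hpos
  set B := 1 + (ε : ℂ) • A with hB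
  have hspec : spectrum ℂ B = (fun k => 1 + (ε : ℂ) * k) '' spectrum ℂ A := by
    have := spectrum.map_polynomial_aeval A (1 + Polynomial.C (ε : ℂ) * Polynomial.X)
    simpa [hB, Algebra.smul_def] using this
  have hrad : spectralRadius ℂ B < ((1 : NNReal) : ENNReal) := by
    apply spectrum.spectralRadius_lt_of_forall_lt_of_nonempty (spectrum.nonempty B)
    intro k hk
    rw [hspec] at hk
    obtain ⟨μ, hμ, rfl⟩ := hk
    exact_mod_cast hε μ hμ
  obtain ⟨r, hr1, hr2⟩ := ENNReal.lt_iff_exists_nnreal_btwn.1 hrad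
  have hr0 : 0 < r := by
    have : (0 : ENNReal) < r := lt_of_le_of_lt (by simp) hr1
    exact_mod_cast this
  have hr2 : r < 1 := by exact_mod_cast hr2
  have hev := (spectrum.pow_nnnorm_pow_one_div_tendsto_nhds_spectralRadius B).eventually_lt_const hr1
  have hO : (fun k => B ^ k) =O[atTop] (fun k : ℕ => (r : ℝ) ^ k) := by
    apply Asymptotics.IsBigO.of_bound 1
    filter_upwards [hev, eventually_gt_atTop 0] with k hk hk0
    have hk' : (‖B ^ k‖₊ : ENNReal) ≤ (r : ENNReal) ^ k := by
      have h := ENNReal.rpow_le_rpow hk.le (Nat.cast_nonneg k : (0 : ℝ) ≤ k)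
      rw [← ENNReal.rpow_mul, one_div, inv_mul_cancel₀ (by positivity), ENNReal.rpow_one,
        ENNReal.rpow_natCast] at h
      exact h
    have hk2 : ‖B ^ k‖₊ ≤ r ^ k := by exact_mod_cast hk'
    have hk3 : ‖B ^ k‖ ≤ (r : ℝ) ^ k := by exact_mod_cast hk2
    rw [one_mul, Real.norm_of_nonneg (by positivity)]
    exact hk3
  obtain ⟨C, hC, hb⟩ := Asymptotics.bound_of_isBigO_nat_atTop hO
  refine ⟨ε, hpos, r, hr0, hr2, C, hC, fun k => ?_⟩
  have := hb (x := k) (by positivity)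
  rwa [Real.norm_of_nonneg (by positivity)] at this

lemma rpow_bound {n : ℕ} (M : Matrix (Fin n) (Fin n) ℝ) (hM : Hurwitz M) :
    ∃ ε > (0 : ℝ), ∃ r : ℝ, 0 < r ∧ r < 1 ∧ ∃ C > (0 : ℝ), ∀ k : ℕ,
      ‖(1 + ε • Matrix.toEuclideanCLM (𝕜 := ℝ) M) ^ k‖ ≤ C * r ^ k := by
  obtain ⟨ε, hε, r, hr0, hr1, C, hC, hb⟩ := cpow_bound _ hM
  let L : Matrix (Fin n) (Fin n) ℂ →ₗ[ℝ] (EuclideanSpace ℝ (Fin n) →L[ℝ] EuclideanSpace ℝ (Fin n)) :=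
    (Matrix.toEuclideanCLM (n := Fin n) (𝕜 := ℝ)).toAlgEquiv.toLinearMap ∘ₗ
      (LinearMap.mapMatrix Complex.reLm)
  obtain ⟨K, hK0, hK⟩ := exists_lin_bound L
  refine ⟨ε, hε, r, hr0, hr1, K * C, by positivity, fun k => ?_⟩
  have h1 : (1 + (ε : ℂ) • M.map (algebraMap ℝ ℂ)) ^ k
      = ((1 + ε • M) ^ k).map (algebraMap ℝ ℂ) := by
    have h2 : (1 + (ε : ℂ) • M.map (algebraMap ℝ ℂ)) = (algebraMap ℝ ℂ).mapMatrix (1 + ε • M) := by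
      rw [map_add, map_one]
      congr 1
      ext i j
      simp
    rw [h2, ← map_pow]
    rfl
  have h3 : L ((1 + (ε : ℂ) • M.map (algebraMap ℝ ℂ)) ^ k)
      = (1 + ε • Matrix.toEuclideanCLM (𝕜 := ℝ) M) ^ k := by
    rw [h1]
    change Matrix.toEuclideanCLM (𝕜 := ℝ) ((((1 + ε • M) ^ k).map (algebraMap ℝ ℂ)).map Complex.reLm) = _
    rw [Matrix.map_map]
    have : (Complex.reLm : ℂ → ℝ) ∘ (algebraMap ℝ ℂ) = id := by
      ext x; simp
    rw [this, Matrix.map_id, map_pow, map_add, map_one, map_smul]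
  rw [← h3]
  calc _ ≤ K * _ := hK _
    _ ≤ K * (C * r ^ k) := by
      gcongr
      exact hb k
    _ = _ := by ring

end PowBound

lemma exp_bound_aux {𝔸 : Type*} [NormedRing 𝔸] [NormedAlgebra ℝ 𝔸] [CompleteSpace 𝔸]
    (A : 𝔸) (ε r C : ℝ) (hε : 0 < ε) (hr0 : 0 < r) (hC : 0 < C)
    (hb : ∀ k : ℕ, ‖(1 + ε • A) ^ k‖ ≤ C * r ^ k) (t : ℝ) (ht : 0 ≤ t) :
    ‖NormedSpace.exp (t • A)‖ ≤ C * Real.exp (-((1 - r) / ε) * t) := by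
  set B := 1 + ε • A with hB
  have hs : 0 ≤ t / ε := by positivity
  set s := t / ε with hs'
  have h1 : t • A = algebraMap ℝ _ (-s) + s • B := by
    rw [hB, smul_add, smul_smul, Algebra.algebraMap_eq_smul_one, hs', div_mul_cancel₀ _ hε.ne']
    rw [neg_smul]; abel
  let _ : NormedAlgebra ℚ 𝔸 :=
    NormedAlgebra.restrictScalars ℚ ℝ _
  rw [h1, NormedSpace.exp_add_of_commute (Algebra.commutes _ _),
    ← NormedSpace.algebraMap_exp_comm, ← Real.exp_eq_exp_ℝ, ← Algebra.smul_def, norm_smul,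
    Real.norm_of_nonneg (Real.exp_pos _).le]
  have h2 : ‖NormedSpace.exp (s • B)‖ ≤ C * Real.exp (s * r) := by
    rw [NormedSpace.exp_eq_tsum ℝ]
    have hsum : HasSum (fun k : ℕ => C * ((s * r) ^ k / k.factorial)) (C * Real.exp (s * r)) := by
      apply HasSum.mul_left
      rw [Real.exp_eq_exp_ℝ]
      exact NormedSpace.expSeries_div_hasSum_exp (s * r)
    refine tsum_of_norm_bounded hsum fun k => ?_
    rw [smul_pow, norm_smul, norm_smul, Real.norm_of_nonneg (by positivity),
      Real.norm_of_nonneg (by positivity), mul_pow]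
    calc _ ≤ ((k.factorial : ℝ))⁻¹ * (s ^ k * (C * r ^ k)) := by
          gcongr; exact hb k
      _ = _ := by field_simp
  calc _ ≤ Real.exp (-s) * (C * Real.exp (s * r)) := by gcongr
    _ = C * (Real.exp (-s) * Real.exp (s * r)) := by ring
    _ = _ := by
      rw [← Real.exp_add]
      congr 2
      rw [hs']; ring

lemma exp_bound {n : ℕ} (M : Matrix (Fin n) (Fin n) ℝ) (hM : Hurwitz M) :
    ∃ a > (0 : ℝ), ∃ C > (0 : ℝ), ∀ t : ℝ, 0 ≤ t →
      ‖NormedSpace.exp (t • Matrix.toEuclideanCLM (𝕜 := ℝ) M)‖ ≤ C * Real.exp (-a * t) := by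
  obtain ⟨ε, hε, r, hr0, hr1, C, hC, hb⟩ := rpow_bound M hM
  exact ⟨(1 - r) / ε, div_pos (by linarith) hε, C, hC,
    fun t ht => exp_bound_aux _ ε r C hε hr0 hC hb t ht⟩

lemma exp_deriv_aux {𝔸 : Type*} [NormedRing 𝔸] [NormedAlgebra ℝ 𝔸] [CompleteSpace 𝔸]
    (A : 𝔸) (t u : ℝ) : HasDerivAt (fun u : ℝ => NormedSpace.exp ((t - u) • A))
      (-(NormedSpace.exp ((t - u) • A) * A)) u := by
  have h : HasDerivAt (fun u : ℝ => NormedSpace.exp ((t - u) • A))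
      ((-1 : ℝ) • (NormedSpace.exp ((t - u) • A) * A)) u :=
    (hasDerivAt_exp_smul_const (𝕂 := ℝ) A (t - u)).scomp u ((hasDerivAt_id u).const_sub t)
  rwa [neg_one_smul] at h

lemma flow_eq {E : Type*} [NormedAddCommGroup E] [NormedSpace ℝ E] [CompleteSpace E]
    (A : E →L[ℝ] E) (x : ℝ → E) (s t : ℝ) (hst : s ≤ t) (hc : ContinuousOn x (Icc s t))
    (hd : ∀ u ∈ Ioo s t, HasDerivAt x (A (x u)) u) :
    x t = NormedSpace.exp ((t - s) • A) (x s) := by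
  rcases hst.eq_or_lt with rfl | hlt
  · simp
  have he : ∀ u : ℝ, HasDerivAt (fun u : ℝ => NormedSpace.exp ((t - u) • A))
      (-(NormedSpace.exp ((t - u) • A) * A)) u := by
    exact fun u => exp_deriv_aux A t u
  let y : ℝ → E := fun u => NormedSpace.exp ((t - u) • A) (x u)
  have hyc : ContinuousOn y (Icc s t) := by
    apply ContinuousOn.clm_apply _ hc
    exact fun u _ => (he u).continuousAt.continuousWithinAt
  have hyd : ∀ u ∈ Ioo s t, HasDerivAt y 0 u := by
    intro u hu
    have h := (he u).clm_apply (hd u hu)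
    simpa using h
  have hconst : ∀ u ∈ Ioo s t, y u = y t := by
    intro u hu
    refine (constant_of_has_deriv_right_zero (f := y) (a := u) (b := t)
      (hyc.mono (Icc_subset_Icc_left hu.1.le)) ?_ t ⟨hu.2.le, le_rfl⟩).symm
    intro v hv
    exact (hyd v ⟨hu.1.trans_le hv.1, hv.2⟩).hasDerivWithinAt
  have hlim : Tendsto y (nhdsWithin s (Ioo s t)) (nhds (y s)) :=
    (hyc s ⟨le_rfl, hst⟩).mono Ioo_subset_Icc_self
  have hlim2 : Tendsto y (nhdsWithin s (Ioo s t)) (nhds (y t)) := by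
    refine tendsto_const_nhds.congr' ?_
    filter_upwards [self_mem_nhdsWithin] with u hu
    exact (hconst u hu).symm
  have : (nhdsWithin s (Ioo s t)).NeBot := left_nhdsWithin_Ioo_neBot hlt
  have := tendsto_nhds_unique hlim hlim2
  simpa [y] using this.symm

lemma finite_discont {P : Type*} (σ : ℝ → P) (h : PiecewiseConstant σ) (s t : ℝ) (hs : 0 ≤ s) :
    (Discont σ ∩ Ioo s t).Finite := by
  obtain ⟨T, hT0, hmono, htop, hconst⟩ := h
  obtain ⟨K, hK⟩ := eventually_atTop.1 (htop.eventually_ge_atTop t)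
  refine ((Set.finite_Iio K).image T).subset ?_
  rintro u ⟨hu, hsu, hut⟩
  by_contra hnot
  apply hu
  have hex : ∃ k, u < T k := ⟨K, hut.trans_le (hK K le_rfl)⟩
  classical
  have hf := Nat.find_spec hex
  have hmin := fun m => Nat.find_min hex (m := m)
  have hfle : Nat.find hex ≤ K := Nat.find_min' hex (hut.trans_le (hK K le_rfl))
  generalize Nat.find hex = m at hf hmin hfle
  cases m with
  | zero => linarith
  | succ k =>
    have h1 : T k ≤ u := not_lt.1 (hmin k (Nat.lt_succ_self k))
    have h2 : T k < u := by
      refine lt_of_le_of_ne h1 fun he => hnot ⟨k, ?_, he⟩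
      exact Nat.lt_of_succ_le hfle
    filter_upwards [Ioo_mem_nhds h2 hf] with v hv
    rw [hconst k v ⟨hv.1.le, hv.2⟩, hconst k u ⟨h1, hf⟩]

lemma const_of_no_discont {P : Type*} (σ : ℝ → P) (s t : ℝ)
    (h : Discont σ ∩ Ioo s t = ∅) : ∀ u ∈ Ioo s t, ∀ v ∈ Ioo s t, σ v = σ u := by
  intro u hu v hv
  refine (isPreconnected_Ioo (a := s) (b := t)).induction₂ (fun x y => σ y = σ x) ?_ ?_ ?_ hu hv
  · intro w hw
    have : w ∉ Discont σ := fun hd => by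
      have : w ∈ Discont σ ∩ Ioo s t := ⟨hd, hw⟩
      rw [h] at this
      exact this
    exact nhdsWithin_le_nhds (not_not.1 this)
  · intro x y z _ _ _ h1 h2
    exact h2.trans h1
  · intro x y _ _ h1
    exact h1.symm

/-- Lemma 3: for a finite family of Hurwitz matrices, any average dwell time `τD > 0`,
chatter bound `N₀ > 0` and rate `λ > 0`, there is a gain `g > 0` such that all solutions of
the switched system `ẋ = g M(σ(t)) x` decay at rate `λ`. -/
theorem lemma3_avg_dwell_time_high_gain_stability
    {n p : ℕ} (hp : 1 ≤ p) (M : Fin p → Matrix (Fin n) (Fin n) ℝ)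
    (hM : ∀ i, Hurwitz (M i)) :
    ∀ τD > (0 : ℝ), ∀ N₀ > (0 : ℝ), ∀ lam > (0 : ℝ), ∃ g > (0 : ℝ), ∃ c' ≥ (1 : ℝ),
      ∀ σ : ℝ → Fin p, HasAvgDwellTime τD N₀ σ →
        ∀ x : ℝ → EuclideanSpace ℝ (Fin n),
          (∀ t ∈ Set.Ici (0 : ℝ),
            HasDerivWithinAt x (g • Matrix.toEuclideanLin (M (σ t)) (x t)) (Set.Ici 0) t) →
          ∀ t ≥ (0 : ℝ), ‖x t‖ ≤ c' * Real.exp (-lam * t) * ‖x 0‖ := by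
  intro τD hτ N₀ hN lam hlam
  have : Nonempty (Fin p) := ⟨⟨0, hp⟩⟩
  choose a ha C hC hb using fun i => exp_bound (M i) (hM i)
  obtain ⟨i₀, hi₀⟩ := Finite.exists_min a
  obtain ⟨j₀, hj₀⟩ := Finite.exists_max C
  set α := a i₀ with hα
  have hαpos : 0 < α := ha i₀
  set c := max 1 (C j₀) with hc
  have hc1 : 1 ≤ c := le_max_left _ _
  have hc0 : 0 < c := by linarith
  have hlog : 0 ≤ Real.log c := Real.log_nonneg hc1
  have hunif : ∀ i, ∀ t : ℝ, 0 ≤ t →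
      ‖NormedSpace.exp (t • Matrix.toEuclideanCLM (𝕜 := ℝ) (M i))‖ ≤ c * Real.exp (-α * t) := by
    intro i t ht
    refine (hb i t ht).trans ?_
    gcongr
    · exact (hj₀ i).trans (le_max_right _ _)
    · exact hi₀ i
  set g := (lam + Real.log c / τD) / α with hg
  have hgpos : 0 < g := by positivity
  refine ⟨g, hgpos, Real.exp (Real.log c * (N₀ + 1)), Real.one_le_exp (by positivity), ?_⟩
  rintro σ ⟨hpc, hdw⟩ x hx t ht
  have hxc : ContinuousOn x (Ici 0) := fun u hu => (hx u hu).continuousWithinAt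
  have key : ∀ k : ℕ, ∀ s t : ℝ, 0 ≤ s → s ≤ t → (Discont σ ∩ Ioo s t).ncard = k →
      ‖x t‖ ≤ c ^ (k + 1) * Real.exp (-(g * α) * (t - s)) * ‖x s‖ := by
    intro k
    induction k using Nat.strong_induction_on with
    | _ k ih =>
    intro s t hs hst hk
    have hfin := finite_discont σ hpc s t hs
    rcases Nat.eq_zero_or_pos k with rfl | hkpos
    · rw [Set.ncard_eq_zero hfin] at hk
      rcases hst.eq_or_lt with rfl | hlt
      · simp
        exact le_mul_of_one_le_left (norm_nonneg _) hc1
      have hcst := const_of_no_discont σ s t hk ((s + t) / 2) ⟨by linarith, by linarith⟩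
      set i := σ ((s + t) / 2)
      have hfl := flow_eq (g • Matrix.toEuclideanCLM (𝕜 := ℝ) (M i)) x s t hst
        (hxc.mono fun u hu => hs.trans hu.1) (by
          intro u hu
          have hu0 : 0 < u := hs.trans_lt hu.1
          have h := (hx u hu0.le).hasDerivAt (Ici_mem_nhds hu0)
          rw [hcst u hu] at h
          exact h)
      rw [hfl, smul_smul]
      refine (ContinuousLinearMap.le_opNorm _ _).trans ?_
      gcongr
      refine (hunif i _ (mul_nonneg (by linarith) hgpos.le)).trans (le_of_eq ?_)
      rw [zero_add, pow_one]
      congr 2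
      ring
    · obtain ⟨d, hdD, hsd, hdt⟩ := (Set.ncard_pos hfin).1 (hk ▸ hkpos)
      have hf1 := finite_discont σ hpc s d hs
      have hf2 := finite_discont σ hpc d t (hs.trans hsd.le)
      have hsplit : Discont σ ∩ Ioo s t
          = insert d ((Discont σ ∩ Ioo s d) ∪ (Discont σ ∩ Ioo d t)) := by
        ext u
        constructor
        · rintro ⟨hu, h1, h2⟩
          rcases lt_trichotomy u d with h | h | h
          · exact Or.inr (Or.inl ⟨hu, h1, h⟩)
          · exact Or.inl h
          · exact Or.inr (Or.inr ⟨hu, h, h2⟩)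
        · rintro (rfl | ⟨hu, h1, h2⟩ | ⟨hu, h1, h2⟩)
          · exact ⟨hdD, hsd, hdt⟩
          · exact ⟨hu, h1, h2.trans hdt⟩
          · exact ⟨hu, hsd.trans h1, h2⟩
      have hcard : k = (Discont σ ∩ Ioo s d).ncard + (Discont σ ∩ Ioo d t).ncard + 1 := by
        rw [← hk, hsplit, Set.ncard_insert_of_notMem _ (hf1.union hf2),
          Set.ncard_union_eq _ hf1 hf2]
        · rw [Set.disjoint_left]
          rintro u ⟨_, _, h1⟩ ⟨_, h2, _⟩
          exact lt_asymm h1 h2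
        · rintro (⟨_, _, h⟩ | ⟨_, h, _⟩) <;> exact lt_irrefl _ h
      have h1 := ih _ (by omega) s d hs hsd.le rfl
      have h2 := ih _ (by omega) d t (hs.trans hsd.le) hdt.le rfl
      generalize (Discont σ ∩ Ioo s d).ncard = k1 at *
      generalize (Discont σ ∩ Ioo d t).ncard = k2 at *
      subst hcard
      calc ‖x t‖ ≤ _ := h2
        _ ≤ c ^ (k2 + 1) * Real.exp (-(g * α) * (t - d)) *
            (c ^ (k1 + 1) * Real.exp (-(g * α) * (d - s)) * ‖x s‖) := by gcongr
        _ = (c ^ (k2 + 1) * c ^ (k1 + 1)) *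
            (Real.exp (-(g * α) * (t - d)) * Real.exp (-(g * α) * (d - s))) * ‖x s‖ := by ring
        _ = _ := by
          rw [← Real.exp_add, ← pow_add]
          congr 3
          · omega
          · ring
  have hk := key _ 0 t le_rfl ht rfl
  have hcount := hdw 0 t le_rfl ht
  refine hk.trans (mul_le_mul_of_nonneg_right ?_ (norm_nonneg _))
  generalize (Discont σ ∩ Ioo 0 t).ncard = k at hcount
  have hpow : c ^ (k + 1) = Real.exp (Real.log c * (k + 1)) := by
    rw [← Real.rpow_natCast, Real.rpow_def_of_pos hc0]
    push_cast
    rfl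
  have hga : g * α = lam + Real.log c / τD := by
    rw [hg, div_mul_cancel₀ _ hαpos.ne']
  rw [hpow, ← Real.exp_add, ← Real.exp_add, hga]
  apply Real.exp_le_exp.2
  have := mul_le_mul_of_nonneg_left hcount hlog
  have e : Real.log c * (t / τD) = Real.log c / τD * t := by ring
  simp only [sub_zero] at *
  nlinarith
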